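/- The graph D₁ does not admit a semi-transitive orientation, where D₁ is the split graph with vertex set {1,2,3,4,5,6} ∪ {a,b,c,d}, in which {1,2,3,4,5,6} induces a complete graph (a clique K₆), {a,b,c,d} is an independent set, and the remaining edges are exactly: a adjacent to 1, 3, 5; b adjacent to 1, 2; c adjacent to 3, 4; d adjacent to 5, 6. -/

import Mathlib

/-- `r` is an orientation of `G`: an irreflexive, asymmetric relation (exactly one direction
per edge) whose symmetric closure is the adjacency relation of `G`. -/
structure IsOrientation {V : Type*} (G : SimpleGraph V) (r : V → V → Prop) : Prop where
  irrefl : ∀ v, ¬ r v v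
  asymm : ∀ u v, r u v → ¬ r v u
  adj_iff : ∀ u v, G.Adj u v ↔ (r u v ∨ r v u)

/-- A relation is acyclic if it has no directed cycle. -/
def RelAcyclic {V : Type*} (r : V → V → Prop) : Prop :=
  ∀ v, ¬ Relation.TransGen r v v

/-- `r` is a semi-transitive orientation of `G`: it is an acyclic orientation and for any
directed path `p 0 → p 1 → ⋯ → p t` (with `t ≥ 1` edges, i.e. at least two vertices),
either there is no edge between the endpoints, or `p i → p j` for all `i < j`. -/
def IsSemiTransitiveOrientation {V : Type*} (G : SimpleGraph V) (r : V → V → Prop) : Prop :=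
  IsOrientation G r ∧ RelAcyclic r ∧
    ∀ (t : ℕ) (p : Fin (t + 1) → V), 1 ≤ t →
      (∀ i : Fin t, r (p i.castSucc) (p i.succ)) →
      (¬ G.Adj (p 0) (p (Fin.last t)) ∨ ∀ i j : Fin (t + 1), i < j → r (p i) (p j))
/-- Neighborhoods in the clique `{1,…,6}` (represented by `Fin 6`, with vertex `i+1`
represented by `i`) of the independent vertices `a, b, c, d` (represented by `Fin 4`):
`a` is adjacent to `1,3,5`; `b` to `1,2`; `c` to `3,4`; `d` to `5,6`. -/
def D1nbr : Fin 4 → Finset (Fin 6)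
  | 0 => {0, 2, 4}
  | 1 => {0, 1}
  | 2 => {2, 3}
  | 3 => {4, 5}

/-- The split graph `D₁`: the clique `{1,…,6}` (as `Fin 6`), the independent set
`{a,b,c,d}` (as `Fin 4`), and edges between them given by `D1nbr`. -/
def D1 : SimpleGraph (Fin 6 ⊕ Fin 4) :=
  SimpleGraph.fromRel fun u v =>
    match u, v with
    | Sum.inl _, Sum.inl _ => True
    | Sum.inl i, Sum.inr a => i ∈ D1nbr a
    | _, _ => False

/-- The pairs `u, v` and `w, t` alternate along `s`, in the order `u, w, v, t` or `w, u, t, v`. -/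
def Alternates {α : Type*} (s : α → α → Prop) (u v w t : α) : Prop :=
  (s u w ∧ s w v ∧ s v t) ∨ (s w u ∧ s u t ∧ s t v)

/-- On a directed path with four vertices and adjacent endpoints, the two chords of length two
are present. -/
theorem IsSemiTransitiveOrientation.chords {V : Type*} {G : SimpleGraph V} {r : V → V → Prop}
    (h : IsSemiTransitiveOrientation G r) {x y z w : V} (hxy : r x y) (hyz : r y z) (hzw : r z w)
    (hxw : G.Adj x w) : r x z ∧ r y w := by
  have hpath : ∀ i : Fin 3, r (![x, y, z, w] i.castSucc) (![x, y, z, w] i.succ) := by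
    intro i
    fin_cases i <;> assumption
  rcases h.2.2 3 ![x, y, z, w] (by norm_num) hpath with hn | hall
  · exact absurd hxw hn
  · exact ⟨hall 0 2 (by decide), hall 1 3 (by decide)⟩

/-- In a semi-transitive orientation, two neighbours of a vertex `a` do not alternate with two
non-neighbours of `a` inside a clique. -/
theorem IsSemiTransitiveOrientation.not_alternates {V : Type*} {G : SimpleGraph V}
    {r : V → V → Prop} (h : IsSemiTransitiveOrientation G r) {a u v w t : V}
    (hau : G.Adj a u) (hav : G.Adj a v) (haw : ¬ G.Adj a w) (hat : ¬ G.Adj a t)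
    (hut : G.Adj u t) (hwv : G.Adj w v) : ¬ Alternates r u v w t := by
  have adj {x y : V} (hr : r x y) : G.Adj x y := (h.1.adj_iff x y).2 (Or.inl hr)
  have no_cycle {x : V} (hux : r u x) (hxv : r x v) (hva : r v a) (hau' : r a u) : False :=
    h.2.1 a ((((Relation.TransGen.single hau').tail hux).tail hxv).tail hva)
  rcases (h.1.adj_iff a u).1 hau with au | ua <;> rcases (h.1.adj_iff a v).1 hav with av | va <;>
    rintro (⟨h₁, h₂, h₃⟩ | ⟨h₁, h₂, h₃⟩)
  · exact haw (adj (h.chords au h₁ h₂ hav).1)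
  · exact hat (adj (h.chords au h₂ h₃ hav).1)
  · exact no_cycle h₁ h₂ va au
  · exact no_cycle h₂ h₃ va au
  · exact hat (adj (h.chords ua av h₃ hut).2)
  · exact haw (adj (h.chords h₁ ua av hwv).1).symm
  · exact haw (adj (h.chords h₁ h₂ va hau.symm).2).symm
  · exact hat (adj (h.chords h₂ h₃ va hau.symm).2).symm

/-- There is no arrangement of `e 0, e 1, e 2, o 0, o 1, o 2` along a relation in which
no two `e`s alternate with two `o`s and no pair `e i, o i` alternates with the other two `e`s. -/
theorem false_of_forall_not_alternates {α : Type*} {s : α → α → Prop} {e o : Fin 3 → α}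
    (total_e : ∀ i j, i ≠ j → s (e i) (e j) ∨ s (e j) (e i))
    (total_eo : ∀ i j, s (e i) (o j) ∨ s (o j) (e i))
    (heo : ∀ i j k l, k ≠ l → ¬ Alternates s (e i) (e j) (o k) (o l))
    (hpair : ∀ i j k, j ≠ i → k ≠ i →
      ¬ Alternates s (e i) (o i) (e j) (e k) ∧ ¬ Alternates s (o i) (e i) (e j) (e k)) :
    False := by
  have sorted : ∀ i j k, i ≠ j → j ≠ k → i ≠ k → s (e i) (e j) → s (e j) (e k) → False := by
    intro i j k hij hjk hik h₁ h₂
    unfold Alternates at *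
    grind
  have h01 := total_e 0 1 (by decide)
  have h12 := total_e 1 2 (by decide)
  have h02 := total_e 0 2 (by decide)
  have := sorted 0 1 2
  have := sorted 0 2 1
  have := sorted 1 0 2
  have := sorted 1 2 0
  have := sorted 2 0 1
  have := sorted 2 1 0
  simp at *
  tauto

theorem D1_adj_inl_inl (i j : Fin 6) : D1.Adj (Sum.inl i) (Sum.inl j) ↔ i ≠ j := by
  simp [D1]

theorem D1_adj_inr_inl (a : Fin 4) (i : Fin 6) :
    D1.Adj (Sum.inr a) (Sum.inl i) ↔ i ∈ D1nbr a := by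
  simp [D1]

/-- The graph `D₁` admits no semi-transitive orientation. -/
theorem stmt10 : ¬ ∃ r : (Fin 6 ⊕ Fin 4) → (Fin 6 ⊕ Fin 4) → Prop,
    IsSemiTransitiveOrientation D1 r := by
  rintro ⟨r, h⟩
  have total {i j : Fin 6} (hij : i ≠ j) :
      r (Sum.inl i) (Sum.inl j) ∨ r (Sum.inl j) (Sum.inl i) :=
    (h.1.adj_iff _ _).1 ((D1_adj_inl_inl i j).2 hij)
  have noalt (a : Fin 4) {u v w t : Fin 6} (hyp : u ∈ D1nbr a ∧ v ∈ D1nbr a ∧ w ∉ D1nbr a ∧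
      t ∉ D1nbr a) :
      ¬ Alternates r (Sum.inl u) (Sum.inl v) (Sum.inl w) (Sum.inl t) := by
    obtain ⟨hu, hv, hw, ht⟩ := hyp
    refine h.not_alternates (a := Sum.inr a) ?_ ?_ ?_ ?_ ?_ ?_ <;>
      simp only [D1_adj_inr_inl, D1_adj_inl_inl] <;> try assumption
    · rintro rfl; exact ht hu
    · rintro rfl; exact hw hv
  refine false_of_forall_not_alternates (s := r) (e := fun i => Sum.inl (![0, 2, 4] i))
    (o := fun i => Sum.inl (![1, 3, 5] i)) ?_ ?_ ?_ ?_
  · exact fun i j hij => total (by revert i j; decide)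
  · exact fun i j => total (by revert i j; decide)
  · exact fun i j k l _ => noalt 0 (by revert i j k l; decide)
  · exact fun i j k hj hk => ⟨noalt i.succ (by revert i j k; decide),
      noalt i.succ (by revert i j k; decide)⟩
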